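/- Let V be a vector space over ℂ, let A_1, …, A_N be nilpotent endomorphisms of V, and let v ∈ V. Then the linear span of {exp(z_1 A_1) ∘ exp(z_2 A_2) ∘ ⋯ ∘ exp(z_N A_N)(v) : (z_1,…,z_N) ∈ ℂ^N} equals the linear span of {A_1^{m_1} ∘ A_2^{m_2} ∘ ⋯ ∘ A_N^{m_N}(v) : (m_1,…,m_N) ∈ ℕ^N}. -/

import Mathlib

open Finset

open scoped Pointwise in
lemma aux_span_prod_list {E : Type*} [Ring E] [Algebra ℂ E] (l : List (Set E)) :
    Submodule.span ℂ l.prod = (l.map (Submodule.span ℂ)).prod := by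
  induction l with
  | nil => simp [Submodule.one_eq_span, ← Set.singleton_one]
  | cons a l ih => simp [← ih, Submodule.span_mul_span]

lemma aux_span_eq {E : Type*} [Ring E] [Algebra ℂ E] (a : E) (n : ℕ) (ha : a ^ n = 0) :
    Submodule.span ℂ (Set.range fun z : ℂ =>
      ∑ k ∈ Finset.range n, (z ^ k / (k.factorial : ℂ)) • a ^ k) =
    Submodule.span ℂ (Set.range fun m : ℕ => a ^ m) := by
  apply le_antisymm
  · rw [Submodule.span_le]
    rintro _ ⟨z, rfl⟩
    exact Submodule.sum_mem _ fun k _ =>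
      Submodule.smul_mem _ _ (Submodule.subset_span ⟨k, rfl⟩)
  · rw [Submodule.span_le]
    rintro _ ⟨m, rfl⟩
    rcases le_or_gt n m with h | h
    · simp [pow_eq_zero_of_le h ha]
    let W : Matrix (Fin n) (Fin n) ℂ := Matrix.vandermonde fun i => ((i : ℕ) : ℂ)
    have hW : IsUnit W.det := by
      rw [isUnit_iff_ne_zero]
      refine Matrix.det_vandermonde_ne_zero_iff.2 fun i j hij => ?_
      exact Fin.ext (by exact_mod_cast hij)
    have hinv := Matrix.nonsing_inv_mul W hW
    let b : Fin n → E := fun k => ((k : ℕ).factorial : ℂ)⁻¹ • a ^ (k : ℕ)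
    have key : b ⟨m, h⟩ = ∑ i, W⁻¹ ⟨m, h⟩ i •
        ∑ k ∈ Finset.range n, ((((i : ℕ) : ℂ)) ^ k / (k.factorial : ℂ)) • a ^ k := by
      have h1 : ∀ i : Fin n, ∑ k ∈ Finset.range n,
          ((((i : ℕ) : ℂ)) ^ k / (k.factorial : ℂ)) • a ^ k = ∑ k, W i k • b k := by
        intro i
        rw [Finset.sum_range]
        simp [W, b, Matrix.vandermonde_apply, smul_smul, div_eq_mul_inv]
      simp_rw [h1, Finset.smul_sum, smul_smul]
      rw [Finset.sum_comm]
      simp_rw [← Finset.sum_smul, ← Matrix.mul_apply, hinv, Matrix.one_apply]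
      simp
    have hm : a ^ m = (m.factorial : ℂ) • b ⟨m, h⟩ := by
      have : (m.factorial : ℂ) ≠ 0 := by exact_mod_cast m.factorial_ne_zero
      simp [b, smul_smul, this]
    change a ^ m ∈ _
    rw [hm, key]
    exact Submodule.smul_mem _ _ (Submodule.sum_mem _ fun i _ =>
      Submodule.smul_mem _ _ (Submodule.subset_span ⟨_, rfl⟩))

open scoped Pointwise in
lemma aux_orbit {V : Type*} [AddCommGroup V] [Module ℂ V] {N : ℕ} {I : Type*}
    (F : Fin N → I → Module.End ℂ V) (v : V) :
    Submodule.span ℂ {w : V | ∃ z : Fin N → I, w = ((List.ofFn fun i => F i (z i)).prod) v} =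
    Submodule.map (LinearMap.applyₗ v)
      (List.ofFn fun i => Submodule.span ℂ (Set.range (F i))).prod := by
  have h : (List.ofFn fun i => Submodule.span ℂ (Set.range (F i))) =
      (List.ofFn fun i => Set.range (F i)).map (Submodule.span ℂ) := by
    rw [List.map_ofFn]; rfl
  rw [h, ← aux_span_prod_list, Submodule.map_span]
  congr 1
  ext w
  simp only [Set.mem_setOf_eq, Set.mem_image, Set.mem_prod_list_ofFn]
  constructor
  · rintro ⟨z, rfl⟩
    exact ⟨_, ⟨fun i => ⟨F i (z i), z i, rfl⟩, rfl⟩, rfl⟩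
  · rintro ⟨_, ⟨f, rfl⟩, rfl⟩
    choose z hz using fun i => (f i).2
    exact ⟨z, by simp [hz]⟩

/-- Let `V` be a complex vector space, `A 1, …, A N` nilpotent endomorphisms of `V`
(with `(A i) ^ (n i) = 0`), and `v ∈ V`. For `z ∈ ℂ^N`, the ordered composition
`exp(z₁A₁) ∘ ⋯ ∘ exp(z_N A_N)` is the product of the finite exponential sums. Then the
linear span of `{exp(z₁A₁)∘⋯∘exp(z_N A_N) v : z ∈ ℂ^N}` equals the linear span of the
ordered monomials `{A₁^{m₁} ∘ ⋯ ∘ A_N^{m_N} v : m ∈ ℕ^N}`. -/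
theorem span_exp_product_orbit_eq_span_ordered_monomials
    (V : Type*) [AddCommGroup V] [Module ℂ V] {N : ℕ}
    (A : Fin N → Module.End ℂ V) (n : Fin N → ℕ) (hA : ∀ i, (A i) ^ (n i) = 0) (v : V) :
    Submodule.span ℂ {w : V | ∃ z : Fin N → ℂ,
        w = ((List.ofFn fun i =>
          ∑ k ∈ Finset.range (n i), ((z i) ^ k / (k.factorial : ℂ)) • ((A i) ^ k)).prod) v} =
    Submodule.span ℂ {w : V | ∃ m : Fin N → ℕ,
        w = ((List.ofFn fun i => (A i) ^ (m i)).prod) v} := by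
  rw [aux_orbit (fun i (z : ℂ) =>
      ∑ k ∈ Finset.range (n i), (z ^ k / (k.factorial : ℂ)) • ((A i) ^ k)) v,
    aux_orbit (fun i (m : ℕ) => (A i) ^ m) v]
  simp_rw [fun i => aux_span_eq (A i) (n i) (hA i)]
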